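/- arXiv:1108.4380 — 5 statements merged into one kernel-verified Lean document; each statement's English description precedes it below -/
import Mathlib

section
/- Let p ∈ ℝ[t] be a monic polynomial of degree d ≥ 1. Then the Hermite matrix H(p) is positive semidefinite if and only if all complex roots of p are real, and H(p) is positive definite if and only if all complex roots of p are real and pairwise distinct. -/
open Matrix Polynomial

/-- The companion matrix of a (monic, degree `d`) univariate real polynomial `p`:
subdiagonal entries `1`, last column `(-p_d, …, -p_1)ᵀ`, i.e. row `i` (0-based) of the
last column is `-p.coeff i`. -/
noncomputable def companionU (d : ℕ) (p : Polynomial ℝ) : Matrix (Fin d) (Fin d) ℝ :=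
  fun i j =>
    if (j : ℕ) = d - 1 then -p.coeff (i : ℕ)
    else if (i : ℕ) = (j : ℕ) + 1 then 1 else 0

/-- The Hermite matrix of `p`: its `(i,j)`-entry (1-based) is the Newton sum
`N_{i+j-2}(p) = trace (C^{i+j-2})` where `C` is the companion matrix. -/
noncomputable def hermiteU (d : ℕ) (p : Polynomial ℝ) : Matrix (Fin d) (Fin d) ℝ :=
  fun i j => Matrix.trace (companionU d p ^ ((i : ℕ) + (j : ℕ)))

namespace Matrix

variable {n K : Type*} [Fintype n] [DecidableEq n] [Field K] [IsAlgClosed K]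

theorem card_roots_charpoly (A : Matrix n n K) :
    A.charpoly.roots.card = Fintype.card n := by
  rw [← (IsAlgClosed.splits A.charpoly).natDegree_eq_card_roots, charpoly_natDegree_eq_dim]

theorem det_aeval_eq_prod_roots_charpoly (A : Matrix n n K) (f : K[X]) :
    (aeval A f).det = (A.charpoly.roots.map fun z => f.eval z).prod := by
  have hf : f.Splits := IsAlgClosed.splits f
  induction hf using Submonoid.closure_induction with
  | mem f hf =>
    rcases hf with ⟨c, rfl⟩ | ⟨c, rfl⟩
    · simp [card_roots_charpoly, algebraMap_eq_diagonal, Pi.algebraMap_def]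
    · have h := (IsAlgClosed.splits A.charpoly).eval_eq_prod_roots_of_monic A.charpoly_monic (-c)
      rw [eval_charpoly] at h
      have h1 : scalar n (-c) - A = -(aeval A (X + C c)) := by
        simp [algebraMap_eq_diagonal, Pi.algebraMap_def, sub_eq_add_neg, scalar_apply,
          add_comm]
      have h2 : (A.charpoly.roots.map fun z => -c - z) =
          (A.charpoly.roots.map fun z => (X + C c : K[X]).eval z).map Neg.neg := by
        rw [Multiset.map_map]
        refine Multiset.map_congr rfl fun z _ => ?_
        simp [sub_eq_add_neg, add_comm]
      rw [h1, h2, det_neg, Multiset.prod_map_neg, Multiset.card_map, card_roots_charpoly] at h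
      exact mul_left_cancel₀ (pow_ne_zero _ (by simp)) h
  | one => simp
  | mul f g _ _ hf hg => simp [hf, hg, Multiset.prod_map_mul]

theorem charpoly_aeval_eq_prod_roots_charpoly (A : Matrix n n K) (f : K[X]) :
    (aeval A f).charpoly = (A.charpoly.roots.map fun z => X - C (f.eval z)).prod := by
  refine Polynomial.funext fun t => ?_
  have h := det_aeval_eq_prod_roots_charpoly A (C t - f)
  rw [eval_charpoly, eval_multiset_prod, Multiset.map_map]
  simpa [algebraMap_eq_diagonal, Pi.algebraMap_def, scalar_apply] using h

theorem trace_aeval_eq_sum_roots_charpoly (A : Matrix n n K) (f : K[X]) :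
    (aeval A f).trace = (A.charpoly.roots.map fun z => f.eval z).sum := by
  have h := charpoly_aeval_eq_prod_roots_charpoly A f
  have h2 : (A.charpoly.roots.map fun z => X - C (f.eval z)) =
      (A.charpoly.roots.map fun z => f.eval z).map fun a => X - C a := by
    rw [Multiset.map_map]; rfl
  rw [trace_eq_sum_roots_charpoly, h, h2, roots_multiset_prod_X_sub_C]

end Matrix

theorem charpoly_companionU {p : ℝ[X]} (hp : p.Monic) :
    (companionU p.natDegree p).charpoly = p := by
  have h1 : companionU p.natDegree p = Algebra.leftMulMatrix
      (AdjoinRoot.powerBasis hp.ne_zero).basis (AdjoinRoot.powerBasis hp.ne_zero).gen := by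
    rw [PowerBasis.leftMulMatrix, PowerBasis.minpolyGen_eq,
      AdjoinRoot.minpoly_powerBasis_gen_of_monic hp]
    ext i j
    have hj : (j : ℕ) < p.natDegree := j.isLt
    have : ((j : ℕ) = p.natDegree - 1) ↔ (j : ℕ) + 1 = p.natDegree := by omega
    simp only [companionU, this]
    rfl
  have h2 := charpoly_leftMulMatrix (AdjoinRoot.powerBasis hp.ne_zero)
  rw [AdjoinRoot.minpoly_powerBasis_gen_of_monic hp] at h2
  rw [h1]
  exact h2

theorem isHermitian_hermiteU (d : ℕ) (p : ℝ[X]) : (hermiteU d p).IsHermitian := by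
  ext i j
  simp [hermiteU, add_comm]

/-- The quadratic form of the Hermite matrix is the sum of squares of the values at the roots. -/
theorem hermiteU_dotProduct_mulVec {p : ℝ[X]} (hp : p.Monic) (x : Fin p.natDegree → ℝ) :
    ((x ⬝ᵥ (hermiteU p.natDegree p *ᵥ x) : ℝ) : ℂ) =
      ((p.map (algebraMap ℝ ℂ)).roots.map fun z =>
        aeval z (Polynomial.ofFn p.natDegree x) ^ 2).sum := by
  set f := Polynomial.ofFn p.natDegree x with hf
  set A := companionU p.natDegree p with hA
  have h1 : x ⬝ᵥ (hermiteU p.natDegree p *ᵥ x) = (aeval A (f ^ 2)).trace := by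
    have h3 : aeval A f = ∑ i : Fin p.natDegree, x i • A ^ (i : ℕ) := by
      rw [hf, Polynomial.ofFn_eq_sum_monomial, map_sum]
      simp [aeval_monomial, Algebra.smul_def]
    rw [map_pow, sq, h3, Finset.sum_mul_sum, trace_sum]
    simp only [dotProduct, mulVec, Finset.mul_sum, trace_sum]
    refine Finset.sum_congr rfl fun i _ => Finset.sum_congr rfl fun j _ => ?_
    simp only [hermiteU, smul_mul_smul_comm, ← pow_add, trace_smul, smul_eq_mul]
    ring
  have h2 : ((aeval A (f ^ 2)).trace : ℂ) =
      (aeval (A.map (algebraMap ℝ ℂ)) ((f ^ 2).map (algebraMap ℝ ℂ))).trace := by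
    rw [aeval_map_algebraMap]
    have h := aeval_algHom_apply
      ((Algebra.ofId ℝ ℂ).mapMatrix : Matrix (Fin p.natDegree) (Fin p.natDegree) ℝ →ₐ[ℝ] _)
      A (f ^ 2)
    exact (AddMonoidHom.map_trace (algebraMap ℝ ℂ) _).trans (congrArg trace h.symm)
  rw [h1, h2, trace_aeval_eq_sum_roots_charpoly, charpoly_map, hA, charpoly_companionU hp]
  simp [eval_map_algebraMap]

/-- Conjugation-invariant values at a conjugation-stable set of nodes are attained by a real
polynomial. -/
theorem exists_aeval_ofFn_eq {s : Finset ℂ} {d : ℕ} (hd : s.card ≤ d) (r : ℂ → ℂ)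
    (hs : ∀ z ∈ s, starRingEnd ℂ z ∈ s)
    (hr : ∀ z, r (starRingEnd ℂ z) = starRingEnd ℂ (r z)) :
    ∃ x : Fin d → ℝ, ∀ z ∈ s, aeval z (Polynomial.ofFn d x) = r z := by
  set g := Lagrange.interpolate s id r
  have hg : ∀ z ∈ s, g.eval z = r z := fun z hz =>
    Lagrange.eval_interpolate_at_node r (Set.injOn_id _) hz
  have hdeg : g.degree < d :=
    (Lagrange.degree_interpolate_lt r (Set.injOn_id _)).trans_le (by exact_mod_cast hd)
  refine ⟨fun i => (g.coeff i).re, fun z hz => ?_⟩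
  have h : (Polynomial.ofFn d fun i : Fin d => (g.coeff i).re).map (algebraMap ℝ ℂ) =
      C (2⁻¹ : ℂ) * (g + g.map (starRingEnd ℂ)) := by
    ext k
    rcases lt_or_ge k d with hk | hk
    · rw [coeff_map, Polynomial.ofFn_coeff_eq_val_of_lt _ hk]
      simp [Complex.re_eq_add_conj]
      ring
    · rw [coeff_map, Polynomial.ofFn_coeff_eq_zero_of_ge _ hk]
      simp [coeff_eq_zero_of_degree_lt (hdeg.trans_le (by exact_mod_cast hk))]
  have hc : (g.map (starRingEnd ℂ)).eval z = r z := by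
    have h3 := eval_map_apply (starRingEnd ℂ) (p := g) (starRingEnd ℂ z)
    rw [Complex.conj_conj, hg _ (hs z hz), hr, Complex.conj_conj] at h3
    exact h3
  rw [← eval_map_algebraMap, h, eval_mul, eval_add, hc, hg z hz, eval_C]
  ring

theorem conj_mem_roots_map {p : ℝ[X]} {z : ℂ} (hz : z ∈ (p.map (algebraMap ℝ ℂ)).roots) :
    starRingEnd ℂ z ∈ (p.map (algebraMap ℝ ℂ)).roots := by
  rw [mem_roots', IsRoot, eval_map_algebraMap] at hz ⊢
  exact ⟨hz.1, by rw [aeval_conj, hz.2, map_zero]⟩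

theorem card_roots_map_complex (p : ℝ[X]) :
    (p.map (algebraMap ℝ ℂ)).roots.card = p.natDegree := by
  rw [← (IsAlgClosed.splits _).natDegree_eq_card_roots, natDegree_map]

theorem im_eq_zero_of_posSemidef_hermiteU {p : ℝ[X]} (hp : p.Monic)
    (h : (hermiteU p.natDegree p).PosSemidef) {z : ℂ}
    (hz : z ∈ (p.map (algebraMap ℝ ℂ)).roots) : z.im = 0 := by
  by_contra him
  have hne : starRingEnd ℂ z ≠ z := fun h => him (Complex.conj_eq_iff_im.mp h)
  obtain ⟨x, hx⟩ := exists_aeval_ofFn_eq (s := (p.map (algebraMap ℝ ℂ)).roots.toFinset)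
    (d := p.natDegree)
    ((Multiset.toFinset_card_le _).trans (card_roots_map_complex p).le)
    (fun w => if w = z then Complex.I else if w = starRingEnd ℂ z then -Complex.I else 0)
    (fun w hw => by
      rw [Multiset.mem_toFinset] at hw ⊢
      exact conj_mem_roots_map hw)
    (fun w => by
      have h1 : starRingEnd ℂ w = z ↔ w = starRingEnd ℂ z :=
        ⟨fun h => by rw [← h, Complex.conj_conj], fun h => by rw [h, Complex.conj_conj]⟩
      have h2 : starRingEnd ℂ w = starRingEnd ℂ z ↔ w = z := (starRingEnd ℂ).injective.eq_iff
      simp only [h1, h2]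
      split_ifs with h3 h4
      · exact absurd (h3.symm.trans h4) hne
      all_goals simp)
  have h0 := h.dotProduct_mulVec_nonneg x
  rw [star_trivial] at h0
  have hq := congrArg Complex.re (hermiteU_dotProduct_mulVec hp x)
  obtain ⟨t, ht⟩ := Multiset.exists_cons_of_mem hz
  have hle : ∀ w ∈ (p.map (algebraMap ℝ ℂ)).roots,
      (aeval w (Polynomial.ofFn p.natDegree x) ^ 2).re ≤ 0 := fun w hw => by
    rw [hx w (Multiset.mem_toFinset.mpr hw)]
    split_ifs <;> simp
  have hz1 : (aeval z (Polynomial.ofFn p.natDegree x) ^ 2).re = -1 := by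
    rw [hx z (Multiset.mem_toFinset.mpr hz)]
    simp
  rw [Complex.ofReal_re, ← Complex.coe_reAddGroupHom, map_multiset_sum, Multiset.map_map] at hq
  rw [ht] at hq hle
  have hsum : (t.map (Complex.re ∘ fun w =>
      aeval w (Polynomial.ofFn p.natDegree x) ^ 2)).sum ≤ 0 := by
    refine (Multiset.sum_le_card_nsmul _ 0 fun y hy => ?_).trans (nsmul_zero _).le
    obtain ⟨w, hw, rfl⟩ := Multiset.mem_map.mp hy
    exact hle w (Multiset.mem_cons_of_mem hw)
  rw [Multiset.map_cons, Multiset.sum_cons, Function.comp_apply, Complex.coe_reAddGroupHom,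
    hz1] at hq
  linarith

/-- If all roots of `p` are real, the Hermite quadratic form is a sum of real squares. -/
theorem hermiteU_dotProduct_mulVec_of_im_eq_zero {p : ℝ[X]} (hp : p.Monic)
    (h : ∀ z ∈ (p.map (algebraMap ℝ ℂ)).roots, z.im = 0) (x : Fin p.natDegree → ℝ) :
    x ⬝ᵥ (hermiteU p.natDegree p *ᵥ x) =
      ((p.map (algebraMap ℝ ℂ)).roots.map fun z =>
        (Polynomial.ofFn p.natDegree x).eval z.re ^ 2).sum := by
  apply Complex.ofReal_injective
  rw [hermiteU_dotProduct_mulVec hp, ← Complex.ofRealHom_eq_coe, map_multiset_sum,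
    Multiset.map_map]
  refine congrArg _ (Multiset.map_congr rfl fun z hz => ?_)
  have hz' : z = algebraMap ℝ ℂ z.re := Complex.ext (by simp) (by simp [h z hz])
  conv_lhs => rw [hz', aeval_algebraMap_apply]
  simp

theorem posSemidef_hermiteU_of_im_eq_zero {p : ℝ[X]} (hp : p.Monic)
    (h : ∀ z ∈ (p.map (algebraMap ℝ ℂ)).roots, z.im = 0) :
    (hermiteU p.natDegree p).PosSemidef := by
  refine .of_dotProduct_mulVec_nonneg (isHermitian_hermiteU _ _) fun x => ?_
  rw [star_trivial, hermiteU_dotProduct_mulVec_of_im_eq_zero hp h]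
  refine Multiset.sum_nonneg fun y hy => ?_
  obtain ⟨w, -, rfl⟩ := Multiset.mem_map.mp hy
  exact sq_nonneg _

theorem posDef_hermiteU_of_nodup {p : ℝ[X]} (hp : p.Monic)
    (h : ∀ z ∈ (p.map (algebraMap ℝ ℂ)).roots, z.im = 0)
    (hnd : (p.map (algebraMap ℝ ℂ)).roots.Nodup) :
    (hermiteU p.natDegree p).PosDef := by
  refine .of_dotProduct_mulVec_pos (isHermitian_hermiteU _ _) fun x hx => ?_
  refine ((posSemidef_hermiteU_of_im_eq_zero hp h).dotProduct_mulVec_nonneg x).lt_of_ne'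
    fun h0 => ?_
  rw [star_trivial, hermiteU_dotProduct_mulVec_of_im_eq_zero hp h] at h0
  have hroot : ∀ z ∈ (p.map (algebraMap ℝ ℂ)).roots,
      (Polynomial.ofFn p.natDegree x).eval z.re = 0 := fun z hz =>
    pow_eq_zero_iff two_ne_zero |>.mp <| Multiset.all_zero_of_le_zero_le_of_sum_eq_zero
      (fun y hy => by
        obtain ⟨w, -, rfl⟩ := Multiset.mem_map.mp hy
        exact sq_nonneg _) h0 _ (Multiset.mem_map_of_mem _ hz)
  have hinj : Set.InjOn Complex.re ((p.map (algebraMap ℝ ℂ)).roots.toFinset : Set ℂ) :=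
    fun z hz w hw hzw => Complex.ext hzw <| by
      rw [h z (Multiset.mem_toFinset.mp hz), h w (Multiset.mem_toFinset.mp hw)]
  have hf := eq_zero_of_degree_lt_of_eval_index_eq_zero _ hinj
    (f := Polynomial.ofFn p.natDegree x)
    (by
      rw [Multiset.toFinset_card_of_nodup hnd, card_roots_map_complex]
      exact Polynomial.ofFn_degree_lt x)
    (fun z hz => hroot z (Multiset.mem_toFinset.mp hz))
  exact hx (Polynomial.injective_ofFn _ (hf.trans (map_zero _).symm))

theorem nodup_roots_of_posDef_hermiteU {p : ℝ[X]} (hp : p.Monic)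
    (hpos : (hermiteU p.natDegree p).PosDef) :
    (p.map (algebraMap ℝ ℂ)).roots.Nodup := by
  have h := fun z => im_eq_zero_of_posSemidef_hermiteU hp hpos.posSemidef (z := z)
  by_contra hnd
  set s := (p.map (algebraMap ℝ ℂ)).roots.toFinset
  have hcard : s.card < p.natDegree := by
    rw [← card_roots_map_complex p]
    refine (Multiset.toFinset_card_le _).lt_of_ne fun h => hnd ?_
    exact Multiset.toFinset_card_eq_card_iff_nodup.mp h
  have hm : (∏ w ∈ s, (X - C w.re) : ℝ[X]).Monic := monic_prod_X_sub_C _ _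
  have hdeg : (∏ w ∈ s, (X - C w.re) : ℝ[X]).natDegree < p.natDegree := by
    rwa [natDegree_finsetProd_X_sub_C_eq_card]
  have hf := Polynomial.ofFn_comp_toFn_eq_id_of_natDegree_lt hdeg
  have hx : Polynomial.toFn p.natDegree (∏ w ∈ s, (X - C w.re) : ℝ[X]) ≠ 0 := fun h0 => by
    rw [h0, map_zero] at hf
    exact hm.ne_zero hf.symm
  refine (hpos.dotProduct_mulVec_pos hx).ne' ?_
  rw [star_trivial, hermiteU_dotProduct_mulVec_of_im_eq_zero hp h, hf]
  refine Multiset.sum_eq_zero fun y hy => ?_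
  obtain ⟨w, hw, rfl⟩ := Multiset.mem_map.mp hy
  rw [eval_prod, Finset.prod_eq_zero (Multiset.mem_toFinset.mpr hw) (by simp)]
  simp

/-- Let `p ∈ ℝ[t]` be monic of degree `d ≥ 1`. Then `H(p)` is positive semidefinite iff all
complex roots of `p` are real, and `H(p)` is positive definite iff all complex roots of `p`
are real and pairwise distinct. -/
theorem hermite_posSemidef_iff_and_posDef_iff
    (p : Polynomial ℝ) (d : ℕ) (hd : 1 ≤ d) (hmonic : p.Monic) (hdeg : p.natDegree = d) :
    ((hermiteU d p).PosSemidef ↔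
      ∀ z ∈ (p.map (algebraMap ℝ ℂ)).roots, z.im = 0) ∧
    ((hermiteU d p).PosDef ↔
      (∀ z ∈ (p.map (algebraMap ℝ ℂ)).roots, z.im = 0) ∧
        (p.map (algebraMap ℝ ℂ)).roots.Nodup) := by
  subst hdeg
  exact ⟨⟨fun h _ hz => im_eq_zero_of_posSemidef_hermiteU hmonic h hz,
      posSemidef_hermiteU_of_im_eq_zero hmonic⟩,
    ⟨fun h => ⟨fun _ hz => im_eq_zero_of_posSemidef_hermiteU hmonic h.posSemidef hz,
      nodup_roots_of_posDef_hermiteU hmonic h⟩,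
      fun h => posDef_hermiteU_of_nodup hmonic h.1 h.2⟩⟩
end

section
/- Let p ∈ ℝ[t] be a monic polynomial of degree d ≥ 1. Then the rank of the Hermite matrix H(p) equals the number of distinct complex roots of p, and the number of positive eigenvalues of H(p) minus the number of negative eigenvalues of H(p) (eigenvalues of the real symmetric matrix H(p), counted with multiplicity) equals the number of distinct real roots of p. -/
open Matrix Polynomial

theorem Matrix.eval_charpoly_eq_prod_roots {K n : Type*} [Field K] [IsAlgClosed K] [Fintype n]
    [DecidableEq n] (A : Matrix n n K) (μ : K) :
    (A.charpoly.roots.map fun x => μ - x).prod = (algebraMap K (Matrix n n K) μ - A).det := by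
  rw [show algebraMap K (Matrix n n K) μ = scalar n μ from rfl, ← eval_charpoly]
  conv_rhs => rw [(IsAlgClosed.splits A.charpoly).eq_prod_roots_of_monic A.charpoly_monic]
  simp [eval_multiset_prod]

theorem Matrix.det_aeval_eq_prod_roots {K n : Type*} [Field K] [IsAlgClosed K] [Fintype n]
    [DecidableEq n] (A : Matrix n n K) (q : K[X]) :
    (aeval A q).det = (A.charpoly.roots.map fun x => q.eval x).prod := by
  have hcard : A.charpoly.roots.card = Fintype.card n := by
    rw [← (IsAlgClosed.splits A.charpoly).natDegree_eq_card_roots, charpoly_natDegree_eq_dim]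
  have hlin (μ : K) : (aeval A (X - C μ)).det =
      (A.charpoly.roots.map fun x => (X - C μ).eval x).prod := by
    have h := A.eval_charpoly_eq_prod_roots μ
    have h1 : aeval A (X - C μ) = -(algebraMap K (Matrix n n K) μ - A) := by simp
    rw [h1, det_neg, ← h, ← hcard, ← Multiset.card_map (fun x => μ - x), ← Multiset.prod_map_neg,
      Multiset.map_map]
    simp
  have hprod (s : Multiset K) : (aeval A (s.map fun μ => X - C μ).prod).det =
      (A.charpoly.roots.map fun x => ((s.map fun μ => X - C μ).prod).eval x).prod := by
    induction s using Multiset.induction_on with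
    | empty => simp
    | cons a s ih =>
      simp only [Multiset.map_cons, Multiset.prod_cons, map_mul, det_mul, ih, hlin, eval_mul,
        Multiset.prod_map_mul]
  rw [(IsAlgClosed.splits q).eq_prod_roots]
  simp only [map_mul, det_mul, hprod, eval_mul, Multiset.prod_map_mul]
  simp [hcard, Matrix.algebraMap_eq_diagonal]

theorem Matrix.charpoly_aeval {K n : Type*} [Field K] [IsAlgClosed K] [Fintype n]
    [DecidableEq n] (A : Matrix n n K) (q : K[X]) :
    (aeval A q).charpoly = (A.charpoly.roots.map fun x => X - C (q.eval x)).prod := by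
  refine Polynomial.funext fun t => ?_
  have h := A.det_aeval_eq_prod_roots (C t - q)
  rw [eval_charpoly, eval_multiset_prod, Multiset.map_map]
  simpa [show algebraMap K (Matrix n n K) t = scalar n t from rfl] using h

theorem Matrix.trace_aeval {K n : Type*} [Field K] [IsAlgClosed K] [Fintype n]
    [DecidableEq n] (A : Matrix n n K) (q : K[X]) :
    (aeval A q).trace = (A.charpoly.roots.map fun x => q.eval x).sum := by
  rw [trace_eq_sum_roots_charpoly, charpoly_aeval]
  have := roots_multiset_prod_X_sub_C (A.charpoly.roots.map fun x => q.eval x)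
  rw [Multiset.map_map] at this
  exact congrArg _ this

theorem companionU_eq_leftMulMatrix {p : ℝ[X]} (hp : p.Monic) :
    companionU p.natDegree p =
      Algebra.leftMulMatrix (AdjoinRoot.powerBasis' hp).basis (AdjoinRoot.root p) := by
  have h := (AdjoinRoot.powerBasis' hp).leftMulMatrix
  have hm : (AdjoinRoot.powerBasis' hp).minpolyGen = p := by
    rw [PowerBasis.minpolyGen_eq, AdjoinRoot.powerBasis'_gen, AdjoinRoot.minpoly_root hp.ne_zero]
    simp [hp.leadingCoeff]
  refine Eq.trans ?_ h.symm
  ext i j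
  rw [hm]
  have : ((j : ℕ) = p.natDegree - 1) ↔ ((j : ℕ) + 1 = p.natDegree) := by
    have : (j : ℕ) < p.natDegree := j.2
    omega
  simp only [companionU, this]
  rfl

theorem hermiteU_apply_eq_sum_roots {p : ℝ[X]} (hp : p.Monic) (i j : Fin p.natDegree) :
    (hermiteU p.natDegree p i j : ℂ) =
      ((p.map (algebraMap ℝ ℂ)).roots.map fun z => z ^ ((i : ℕ) + (j : ℕ))).sum := by
  have h := ((companionU p.natDegree p).map (algebraMap ℝ ℂ)).trace_aeval (X ^ ((i : ℕ) + (j : ℕ)))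
  rw [Matrix.charpoly_map, charpoly_companionU hp] at h
  simp only [map_pow, aeval_X, eval_pow, eval_X] at h
  rw [← h, ← RingHom.mapMatrix_apply, ← map_pow]
  exact AddMonoidHom.map_trace (algebraMap ℝ ℂ) (companionU p.natDegree p ^ ((i : ℕ) + (j : ℕ)))

/-- Half of Sylvester's law of inertia, in the form of an inequality: the number of positive weights
of a diagonal form pulled back along a surjection is the least possible. -/
theorem card_pos_le_of_sum_weighted_sq_eq {V ι κ : Type*} [AddCommGroup V] [Module ℝ V]
    [Fintype ι] [Fintype κ] {w : ι → ℝ} {u : κ → ℝ} {L : V →ₗ[ℝ] ι → ℝ} {M : V →ₗ[ℝ] κ → ℝ}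
    (hL : Function.Surjective L)
    (h : ∀ x, ∑ i, w i * L x i ^ 2 = ∑ k, u k * M x k ^ 2) :
    Fintype.card {i // 0 < w i} ≤ Fintype.card {k // 0 < u k} := by
  obtain ⟨s, hs⟩ := L.exists_rightInverse_of_surjective (LinearMap.range_eq_top.2 hL)
  let e : ({i // 0 < w i} → ℝ) →ₗ[ℝ] ι → ℝ := Function.ExtendByZero.linearMap ℝ Subtype.val
  let f : ({i // 0 < w i} → ℝ) →ₗ[ℝ] {k // 0 < u k} → ℝ :=
    LinearMap.funLeft ℝ ℝ Subtype.val ∘ₗ M ∘ₗ s ∘ₗ e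
  suffices Function.Injective f by simpa using LinearMap.finrank_le_finrank_of_injective this
  refine (injective_iff_map_eq_zero f).2 fun x hx => ?_
  have hLs : L (s (e x)) = e x := LinearMap.congr_fun hs (e x)
  have he (i : ι) (hi : ¬ 0 < w i) : e x i = 0 :=
    Function.extend_apply' _ _ _ fun ⟨a, ha⟩ => hi (ha ▸ a.2)
  have hnonneg (i : ι) : 0 ≤ w i * e x i ^ 2 := by
    by_cases hi : 0 < w i
    · positivity
    · simp [he i hi]
  have hle : ∑ i, w i * e x i ^ 2 ≤ 0 := by
    have hh := h (s (e x))
    rw [hLs] at hh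
    rw [hh]
    refine Finset.sum_nonpos fun k _ => ?_
    by_cases hk : 0 < u k
    · have : M (s (e x)) k = 0 := congrFun hx ⟨k, hk⟩
      simp [this]
    · exact mul_nonpos_of_nonpos_of_nonneg (not_lt.1 hk) (sq_nonneg _)
  have hzero := (Finset.sum_eq_zero_iff_of_nonneg fun i _ => hnonneg i).1
    (le_antisymm hle (Finset.sum_nonneg fun i _ => hnonneg i))
  ext i
  have hi : e x i = x i := Subtype.val_injective.extend_apply x 0 i
  have := hzero i (Finset.mem_univ _)
  rw [hi] at this
  simpa [i.2.ne'] using this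

theorem Matrix.IsHermitian.card_filter_roots_charpoly {n : Type*} [Fintype n] [DecidableEq n]
    {A : Matrix n n ℝ} (hA : A.IsHermitian) (P : ℝ → Prop) [DecidablePred P] :
    (A.charpoly.roots.filter P).card = Fintype.card {i // P (hA.eigenvalues i)} := by
  rw [hA.roots_charpoly_eq_eigenvalues, Multiset.filter_map, Multiset.card_map,
    Fintype.card_subtype, Finset.card_def]
  rfl

theorem Matrix.IsHermitian.exists_linearEquiv_sum_eigenvalues {n : Type*} [Fintype n]
    [DecidableEq n] {A : Matrix n n ℝ} (hA : A.IsHermitian) :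
    ∃ M : (n → ℝ) ≃ₗ[ℝ] n → ℝ, ∀ x, x ⬝ᵥ A *ᵥ x = ∑ i, hA.eigenvalues i * M x i ^ 2 := by
  let U : Matrix n n ℝ := hA.eigenvectorUnitary
  have hU : star U * U = 1 := Unitary.coe_star_mul_self hA.eigenvectorUnitary
  have hU' : U * star U = 1 := Unitary.coe_mul_star_self hA.eigenvectorUnitary
  refine ⟨Matrix.toLin'OfInv hU' hU, fun x => ?_⟩
  have hs : A = U * diagonal hA.eigenvalues * star U := by
    simpa [Unitary.conjStarAlgAut_apply] using hA.spectral_theorem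
  have hM : Matrix.toLin'OfInv hU' hU x = star U *ᵥ x  :=
    Matrix.toLin'_apply (star U) x
  conv_lhs => rw [hs]
  rw [hM, ← mulVec_mulVec, ← mulVec_mulVec, dotProduct_mulVec, ← mulVec_transpose]
  simp only [dotProduct, mulVec_diagonal]
  refine Finset.sum_congr rfl fun i _ => ?_
  have : Uᵀ = star U := by simp [star_eq_conjTranspose]
  rw [this]
  ring

section Inertia

variable {n ι : Type*} [Fintype n] [DecidableEq n] [Fintype ι] {A : Matrix n n ℝ} {w : ι → ℝ}
  {L : (n → ℝ) →ₗ[ℝ] ι → ℝ}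

theorem Matrix.IsHermitian.card_pos_eigenvalues_eq (hA : A.IsHermitian)
    (hL : Function.Surjective L) (h : ∀ x, x ⬝ᵥ A *ᵥ x = ∑ i, w i * L x i ^ 2) :
    Fintype.card {i // 0 < hA.eigenvalues i} = Fintype.card {i // 0 < w i} := by
  obtain ⟨M, hM⟩ := hA.exists_linearEquiv_sum_eigenvalues
  exact le_antisymm
    (card_pos_le_of_sum_weighted_sq_eq (L := M.toLinearMap) M.surjective
      fun x => (hM x).symm.trans (h x))
    (card_pos_le_of_sum_weighted_sq_eq (M := M.toLinearMap) hL fun x => (h x).symm.trans (hM x))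

theorem Matrix.IsHermitian.card_neg_eigenvalues_eq (hA : A.IsHermitian)
    (hL : Function.Surjective L) (h : ∀ x, x ⬝ᵥ A *ᵥ x = ∑ i, w i * L x i ^ 2) :
    Fintype.card {i // hA.eigenvalues i < 0} = Fintype.card {i // w i < 0} := by
  obtain ⟨M, hM⟩ := hA.exists_linearEquiv_sum_eigenvalues
  have hh x : ∑ i, (-hA.eigenvalues i) * M x i ^ 2 = ∑ i, (-w i) * L x i ^ 2 := by
    simp [← hM, ← h]
  simp_rw [← neg_pos (a := hA.eigenvalues _), ← neg_pos (a := w _)]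
  exact le_antisymm
    (card_pos_le_of_sum_weighted_sq_eq (L := M.toLinearMap) M.surjective hh)
    (card_pos_le_of_sum_weighted_sq_eq (M := M.toLinearMap) hL fun x => (hh x).symm)

end Inertia

theorem Matrix.IsHermitian.rank_eq_card_pos_add_card_neg {n : Type*} [Fintype n] [DecidableEq n]
    {A : Matrix n n ℝ} (hA : A.IsHermitian) :
    A.rank = Fintype.card {i // 0 < hA.eigenvalues i} +
      Fintype.card {i // hA.eigenvalues i < 0} := by
  rw [hA.rank_eq_card_non_zero_eigs]
  simp_rw [Fintype.card_subtype]
  rw [← Finset.card_union_of_disjoint, ← Finset.filter_or]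
  · simp_rw [ne_iff_lt_or_gt, or_comm]
  · exact Finset.disjoint_filter.2 fun i _ h => h.not_gt

theorem Polynomial.rootMultiplicity_conj (p : ℝ[X]) (z : ℂ) :
    (p.map (algebraMap ℝ ℂ)).rootMultiplicity (starRingEnd ℂ z) =
      (p.map (algebraMap ℝ ℂ)).rootMultiplicity z := by
  conv_rhs => rw [eq_rootMultiplicity_map (RingHom.injective (starRingEnd ℂ)), map_map]
  congr 2
  ext x
  simp

/-- The linear form on coefficient vectors given by the real part (for `0 ≤ z.im`) or the imaginary
part (for `z.im < 0`) of the value at `z`. -/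
noncomputable def evalPart (d : ℕ) (z : ℂ) : (Fin d → ℝ) →ₗ[ℝ] ℝ :=
  (if z.im < 0 then Complex.imLm else Complex.reLm) ∘ₗ
    Fintype.linearCombination ℝ fun i : Fin d => z ^ (i : ℕ)

theorem evalPart_apply (d : ℕ) (z : ℂ) (x : Fin d → ℝ) :
    evalPart d z x =
      if z.im < 0 then (∑ i, (x i : ℂ) * z ^ (i : ℕ)).im else (∑ i, (x i : ℂ) * z ^ (i : ℕ)).re := by
  unfold evalPart
  split_ifs <;> simp [Fintype.linearCombination_apply]

theorem sum_ofReal_re_mul_pow {d : ℕ} (a : Fin d → ℂ) (z : ℂ) :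
    2 * ∑ i, ((a i).re : ℂ) * z ^ (i : ℕ) =
      ∑ i, a i * z ^ (i : ℕ) + starRingEnd ℂ (∑ i, a i * starRingEnd ℂ z ^ (i : ℕ)) := by
  simp only [map_sum, map_mul, map_pow, Complex.conj_conj, ← Finset.sum_add_distrib, Finset.mul_sum,
    ← add_mul, Complex.add_conj]
  exact Finset.sum_congr rfl fun i _ => by push_cast; ring

theorem evalPart_surjective {d : ℕ} {s : Finset ℂ} (hs : ∀ z ∈ s, starRingEnd ℂ z ∈ s)
    (hd : s.card ≤ d) :
    Function.Surjective (LinearMap.pi fun z : s => evalPart d (z : ℂ)) := by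
  intro y
  let t : ℂ → ℝ := fun z => if hz : z ∈ s then y ⟨z, hz⟩ else 0
  let r : ℂ → ℂ := fun z =>
    if z.im = 0 then (t z : ℂ) else if z.im < 0 then 2 * Complex.I * t z else 2 * t z
  let g : ℂ[X] := Lagrange.interpolate s id r
  have hg (z : ℂ) (hz : z ∈ s) : ∑ i : Fin d, g.coeff i * z ^ (i : ℕ) = r z := by
    rw [← Lagrange.eval_interpolate_at_node r (Set.injOn_id _) hz,
      eval_eq_sum]
    refine sum_fin (fun e a => a * z ^ e) (fun i => zero_mul _) ?_
    exact (Lagrange.degree_interpolate_lt r (Set.injOn_id _)).trans_le (by exact_mod_cast hd)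
  refine ⟨fun i => (g.coeff i).re, ?_⟩
  ext ⟨z, hz⟩
  have h2 := sum_ofReal_re_mul_pow (fun i : Fin d => g.coeff i) z
  rw [hg z hz, hg _ (hs z hz)] at h2
  have hre := congrArg Complex.re h2
  have him := congrArg Complex.im h2
  have ht : t z = y ⟨z, hz⟩ := dif_pos hz
  rw [LinearMap.pi_apply, evalPart_apply, ← ht]
  rcases lt_trichotomy z.im 0 with h | h | h
  · simp [r, h, h.ne, h.not_gt] at hre him ⊢
    linarith
  · simp [r, h, Complex.conj_eq_iff_im.2 h] at hre him ⊢
    linarith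
  · simp [r, h, h.ne', h.not_gt] at hre him ⊢
    linarith

theorem re_sum_mul_sq_eq_sum_evalPart {d : ℕ} {s : Finset ℂ} {m : ℂ → ℝ}
    (hs : ∀ z ∈ s, starRingEnd ℂ z ∈ s) (hm : ∀ z, m (starRingEnd ℂ z) = m z) (x : Fin d → ℝ) :
    (∑ z ∈ s, (m z : ℂ) * (∑ i, (x i : ℂ) * z ^ (i : ℕ)) ^ 2).re =
      ∑ z ∈ s, (if z.im < 0 then -2 * m z else if z.im = 0 then m z else 2 * m z) *
        evalPart d z x ^ 2 := by
  have hconj (F : ℂ → ℝ) : ∑ z ∈ s, F (starRingEnd ℂ z) = ∑ z ∈ s, F z :=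
    Finset.sum_nbij' (starRingEnd ℂ) (starRingEnd ℂ) hs hs (by simp) (by simp) (by simp)
  have hf (z : ℂ) : ∑ i, (x i : ℂ) * starRingEnd ℂ z ^ (i : ℕ) =
      starRingEnd ℂ (∑ i, (x i : ℂ) * z ^ (i : ℕ)) := by simp
  rw [Complex.re_sum]
  suffices h : ∀ F G : ℂ → ℝ, (∀ z, F z + F (starRingEnd ℂ z) = G z + G (starRingEnd ℂ z)) →
      ∑ z ∈ s, F z = ∑ z ∈ s, G z by
    refine h _ _ fun z => ?_
    simp only [evalPart_apply, hf, hm, Complex.conj_im, Complex.conj_re]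
    have him (h : z.im = 0) : (∑ i, (x i : ℂ) * z ^ (i : ℕ)).im = 0 := by
      rw [← Complex.conj_eq_iff_im, ← hf, Complex.conj_eq_iff_im.2 h]
    generalize ∑ i, (x i : ℂ) * z ^ (i : ℕ) = c at him ⊢
    rcases lt_trichotomy z.im 0 with h | h | h
    · simp [pow_two, h, h.ne, h.not_gt]
      ring
    · simp [pow_two, h, him h]
    · simp [pow_two, h, h.ne', h.not_gt]
      ring
  intro F G h
  have := Finset.sum_congr (rfl : s = s) fun z _ => h z
  rw [Finset.sum_add_distrib, Finset.sum_add_distrib, hconj, hconj] at this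
  linarith

theorem dotProduct_hermiteU_mulVec {p : ℝ[X]} (hp : p.Monic) (x : Fin p.natDegree → ℝ) :
    ((x ⬝ᵥ hermiteU p.natDegree p *ᵥ x : ℝ) : ℂ) =
      ∑ z ∈ (p.map (algebraMap ℝ ℂ)).roots.toFinset,
        (((p.map (algebraMap ℝ ℂ)).rootMultiplicity z : ℝ) : ℂ) *
          (∑ i, (x i : ℂ) * z ^ (i : ℕ)) ^ 2 := by
  simp only [dotProduct, mulVec, Complex.ofReal_sum, Complex.ofReal_mul,
    hermiteU_apply_eq_sum_roots hp, Finset.sum_multiset_map_count, count_roots, nsmul_eq_mul,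
    pow_two (∑ i, _), Finset.mul_sum, Finset.sum_mul, Complex.ofReal_natCast]
  rw [Finset.sum_comm]
  conv_rhs =>
    rw [Finset.sum_comm]
    enter [2, i]
    rw [Finset.sum_comm]
  rw [Finset.sum_comm]
  refine Finset.sum_congr rfl fun i _ => Finset.sum_congr rfl fun j _ =>
    Finset.sum_congr rfl fun z _ => ?_
  rw [pow_add]
  ring

theorem card_filter_im_eq_zero_roots (p : ℝ[X]) :
    ((p.map (algebraMap ℝ ℂ)).roots.toFinset.filter fun z => z.im = 0).card =
      p.roots.toFinset.card := by
  rcases eq_or_ne p 0 with rfl | hp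
  · simp
  have hp' : p.map (algebraMap ℝ ℂ) ≠ 0 := (Polynomial.map_ne_zero_iff Complex.ofReal_injective).2 hp
  rw [← Finset.card_image_of_injective p.roots.toFinset Complex.ofReal_injective]
  congr 1
  ext z
  simp only [Finset.mem_filter, Multiset.mem_toFinset, mem_roots hp', Finset.mem_image, mem_roots hp]
  constructor
  · rintro ⟨h, hz⟩
    have hz' : (algebraMap ℝ ℂ z.re) = z := Complex.ext rfl hz.symm
    refine ⟨z.re, ?_, hz'⟩
    rw [← hz'] at h
    exact h.of_map Complex.ofReal_injective
  · rintro ⟨r, hr, rfl⟩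
    exact ⟨hr.map (f := algebraMap ℝ ℂ), Complex.ofReal_im r⟩

/-- Let `p ∈ ℝ[t]` be monic of degree `d ≥ 1`. Then the rank of `H(p)` equals the number of
distinct complex roots of `p`, and the signature of `H(p)` — the number of positive
eigenvalues minus the number of negative eigenvalues, counted with multiplicity as roots of
the characteristic polynomial — equals the number of distinct real roots of `p`. -/
theorem hermite_rank_and_signature
    (p : Polynomial ℝ) (d : ℕ) (hd : 1 ≤ d) (hmonic : p.Monic) (hdeg : p.natDegree = d) :
    (hermiteU d p).rank = (p.map (algebraMap ℝ ℂ)).roots.toFinset.card ∧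
    ((((hermiteU d p).charpoly.roots.filter (fun x => 0 < x)).card : ℤ) -
        (((hermiteU d p).charpoly.roots.filter (fun x => x < 0)).card : ℤ)) =
      (p.roots.toFinset.card : ℤ) := by

  subst hdeg
  set q := p.map (algebraMap ℝ ℂ)
  have hq : q ≠ 0 := (hmonic.map _).ne_zero
  let s := q.roots.toFinset
  let m : ℂ → ℝ := fun z => q.rootMultiplicity z
  let w : ℂ → ℝ := fun z => if z.im < 0 then -2 * m z else if z.im = 0 then m z else 2 * m z
  have hmem (z : ℂ) : z ∈ s ↔ 0 < m z := by
    simp [s, m, rootMultiplicity_pos hq, mem_roots hq]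
  have hm (z : ℂ) : m (starRingEnd ℂ z) = m z := congrArg Nat.cast (p.rootMultiplicity_conj z)
  have hs (z : ℂ) (hz : z ∈ s) : starRingEnd ℂ z ∈ s := by rwa [hmem, hm, ← hmem]
  have hcard : s.card ≤ p.natDegree :=
    (Multiset.toFinset_card_le _).trans ((card_roots' q).trans_eq (natDegree_map _))
  have hH := isHermitian_hermiteU p.natDegree p
  have hsurj := evalPart_surjective hs hcard
  have hform (x : Fin p.natDegree → ℝ) : x ⬝ᵥ hermiteU p.natDegree p *ᵥ x =
      ∑ z : s, w z * (LinearMap.pi fun z : s => evalPart p.natDegree (z : ℂ)) x z ^ 2 := by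
    rw [← Complex.ofReal_re (x ⬝ᵥ _), dotProduct_hermiteU_mulVec hmonic,
      re_sum_mul_sq_eq_sum_evalPart hs hm, ← Finset.sum_coe_sort]
    rfl
  have hpos : Fintype.card {z : s // 0 < w z} = (s.filter fun z => ¬ z.im < 0).card := by
    rw [Fintype.card_subtype, ← Finset.card_map (Function.Embedding.subtype _)]
    congr 1
    ext z
    have := hmem z
    simp
    grind
  have hneg : Fintype.card {z : s // w z < 0} = (s.filter fun z => z.im < 0).card := by
    rw [Fintype.card_subtype, ← Finset.card_map (Function.Embedding.subtype _)]
    congr 1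
    ext z
    have := hmem z
    simp
    grind
  have hsplit : (s.filter fun z => ¬ z.im < 0).card =
      (s.filter fun z => z.im = 0).card + (s.filter fun z => 0 < z.im).card := by
    rw [← Finset.card_union_of_disjoint, ← Finset.filter_or]
    · congr! 2 with z
      rw [not_lt, le_iff_eq_or_lt, eq_comm]
    · exact Finset.disjoint_filter.2 fun z _ h => h.not_gt
  have hconj : (s.filter fun z => 0 < z.im).card = (s.filter fun z => z.im < 0).card :=
    Finset.card_nbij' (starRingEnd ℂ) (starRingEnd ℂ) (by intro z; simp +contextual [hs])
      (by intro z; simp +contextual [hs]) (by intro z; simp) (by intro z; simp)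
  have hreal : (s.filter fun z => z.im = 0).card = p.roots.toFinset.card :=
    card_filter_im_eq_zero_roots p
  rw [hH.rank_eq_card_pos_add_card_neg, hH.card_filter_roots_charpoly,
    hH.card_filter_roots_charpoly, hH.card_pos_eigenvalues_eq hsurj hform,
    hH.card_neg_eigenvalues_eq hsurj hform, hpos, hneg]
  refine ⟨?_, by omega⟩
  rw [add_comm]
  exact Finset.card_filter_add_card_filter_not _
end

section
/- Let p ∈ ℝ[x₁,…,xₙ] with p(0) = 1 and deg p = d ≥ 1. Then p is a real-zero polynomial if and only if the matrix 𝓗(p)(a), obtained by evaluating every entry of the parametrized Hermite matrix 𝓗(p) at the point a, is positive semidefinite for every a ∈ ℝⁿ. -/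
open Matrix

/-- Write `p = Σ_{i=0}^d p_i` with `p_i` homogeneous of degree `i`, and let
`P(x,t) = Σ_{i=0}^d p_i t^{d-i}` be the homogenization of `p` with respect to `t`.
This is the companion matrix `L_t` of `P` (as a monic polynomial in `t` of degree `d`):
subdiagonal entries `1`, last column `(-p_d, -p_{d-1}, …, -p_1)ᵀ`. -/
noncomputable def companionM {n : ℕ} (d : ℕ) (p : MvPolynomial (Fin n) ℝ) :
    Matrix (Fin d) (Fin d) (MvPolynomial (Fin n) ℝ) := fun i j =>
  if (j : ℕ) = d - 1 then -(MvPolynomial.homogeneousComponent (d - (i : ℕ)) p)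
  else if (i : ℕ) = (j : ℕ) + 1 then 1 else 0

/-- The parametrized Hermite matrix `𝓗(p)` of `p` (for `p` of degree `d`): the `d × d`
matrix over `ℝ[x₁,…,xₙ]` whose `(i,j)`-entry (1-based) is the Newton sum
`N_{i+j-2}(P) = trace (L_t^{i+j-2})`. -/
noncomputable def hermiteM {n : ℕ} (d : ℕ) (p : MvPolynomial (Fin n) ℝ) :
    Matrix (Fin d) (Fin d) (MvPolynomial (Fin n) ℝ) := fun i j =>
  Matrix.trace (companionM d p ^ ((i : ℕ) + (j : ℕ)))

/-- A polynomial `p ∈ ℝ[x₁,…,xₙ]` with `p(0) = 1` is a real-zero polynomial if for every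
`a ∈ ℝⁿ` all complex roots of the univariate polynomial `t ↦ p(ta)` are real. -/
def IsRealZero {n : ℕ} (p : MvPolynomial (Fin n) ℝ) : Prop :=
  MvPolynomial.constantCoeff p = 1 ∧
  ∀ (a : Fin n → ℝ) (z : ℂ),
    (MvPolynomial.aeval (fun i => z * algebraMap ℝ ℂ (a i))) p = 0 → z.im = 0

/-- The symmetric linear matrix polynomial `𝓜 = x₁M₁ + ⋯ + xₙMₙ` determined by
matrices `M₁, …, Mₙ`. -/
noncomputable def pencil {n k : ℕ} (M : Fin n → Matrix (Fin k) (Fin k) ℝ) :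
    Matrix (Fin k) (Fin k) (MvPolynomial (Fin n) ℝ) := fun i j =>
  ∑ l, MvPolynomial.X l * MvPolynomial.C (M l i j)

open Polynomial in
/-- The determinant of `q(A)` is the product of the values of `q` at the eigenvalues of `A`. -/
theorem Matrix.det_aeval_eq_prod_roots_charpoly_s2 {m K : Type*} [Fintype m] [DecidableEq m]
    [Field K] [IsAlgClosed K] (A : Matrix m m K) (q : K[X]) :
    (aeval A q).det = (A.charpoly.roots.map (q.eval ·)).prod := by
  have hA := IsAlgClosed.splits A.charpoly
  have hcard : A.charpoly.roots.card = Fintype.card m := by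
    rw [← hA.natDegree_eq_card_roots, A.charpoly_natDegree_eq_dim]
  have hlin (μ : K) : (aeval A (X - C μ)).det = (A.charpoly.roots.map (· - μ)).prod := by
    have h1 : aeval A (X - C μ) = -(scalar m μ - A) := by
      simp [Matrix.algebraMap_eq_diagonal, Pi.algebraMap_def]
    rw [h1, det_neg, ← eval_charpoly, hA.eval_eq_prod_roots_of_monic A.charpoly_monic, ← hcard,
      ← Multiset.card_map (μ - ·), ← Multiset.prod_map_neg]
    simp [Multiset.map_map]
  conv_lhs => rw [(IsAlgClosed.splits q).eq_prod_roots]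
  have hprod : (aeval A (q.roots.map (X - C ·)).prod).det =
      (q.roots.map fun μ => (aeval A (X - C μ)).det).prod :=
    (map_multiset_prod (detMonoidHom.comp (aeval A : K[X] →ₐ[K] Matrix m m K).toMonoidHom)
      _).trans (by rw [Multiset.map_map]; rfl)
  simp_rw [map_mul, det_mul, hprod, hlin, (IsAlgClosed.splits q).eval_eq_prod_roots,
    Multiset.prod_map_mul, aeval_C, algebraMap_eq_diagonal]
  rw [Multiset.prod_map_prod_map]
  simp [hcard]

open Polynomial in
/-- The trace of `A ^ k` is the sum of the `k`-th powers of the eigenvalues of `A`. -/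
theorem Matrix.trace_pow_eq_sum_roots_charpoly {m K : Type*} [Fintype m] [DecidableEq m]
    [Field K] [IsAlgClosed K] (A : Matrix m m K) (k : ℕ) :
    (A ^ k).trace = (A.charpoly.roots.map (· ^ k)).sum := by
  have h : (A ^ k).charpoly = ((A.charpoly.roots.map (· ^ k)).map (X - C ·)).prod := by
    have : Infinite K := IsAlgClosed.instInfinite
    refine Polynomial.funext fun c => ?_
    have h1 : aeval A (C c - X ^ k) = scalar m c - A ^ k := by
      simp [Matrix.algebraMap_eq_diagonal, Pi.algebraMap_def]
    rw [eval_charpoly, ← h1, det_aeval_eq_prod_roots_charpoly_s2]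
    simp [eval_multiset_prod]
  rw [trace_eq_sum_roots_charpoly, h, roots_multiset_prod_X_sub_C]

open scoped ComplexOrder in
/-- A real positive semidefinite matrix is positive semidefinite over `ℂ`. -/
theorem Matrix.PosSemidef.map_ofReal {m : Type*} [Fintype m] {A : Matrix m m ℝ}
    (hA : A.PosSemidef) : (A.map Complex.ofReal).PosSemidef := by
  obtain ⟨k, v, rfl⟩ := posSemidef_iff_eq_sum_vecMulVec.1 hA
  refine posSemidef_iff_eq_sum_vecMulVec.2 ⟨k, fun i j => (v i j : ℂ), ?_⟩
  ext i j
  simp [Matrix.sum_apply, vecMulVec_apply]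

open Polynomial ComplexConjugate ComplexOrder in
/-- Hermite's criterion: the Hankel matrix of the power traces of a real matrix `A` is positive
semidefinite if and only if all eigenvalues of `A` are real. -/
theorem Matrix.posSemidef_trace_pow_iff {d : ℕ} (A : Matrix (Fin d) (Fin d) ℝ) :
    (Matrix.of fun i j : Fin d => (A ^ ((i : ℕ) + (j : ℕ))).trace).PosSemidef ↔
      ∀ z : ℂ, aeval z A.charpoly = 0 → z.im = 0 := by
  set s := (A.map Complex.ofReal).charpoly.roots with hs
  have hmem (z : ℂ) : z ∈ s ↔ aeval z A.charpoly = 0 := by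
    have h1 : (A.map Complex.ofReal).charpoly = A.charpoly.map (algebraMap ℝ ℂ) :=
      charpoly_map A (algebraMap ℝ ℂ)
    rw [hs, mem_roots (charpoly_monic _).ne_zero, h1, IsRoot.def, eval_map_algebraMap]
  have htr (k : ℕ) : (((A ^ k).trace : ℝ) : ℂ) = ∑ z : s, (z : ℂ) ^ k := by
    have h1 : (((A ^ k).trace : ℝ) : ℂ) = ((A.map Complex.ofReal) ^ k).trace := by
      have h2 : (A.map Complex.ofReal) ^ k = (A ^ k).map Complex.ofReal :=
        (map_pow (Complex.ofRealHom.mapMatrix (m := Fin d)) A k).symm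
      simp [h2, trace]
    rw [h1, trace_pow_eq_sum_roots_charpoly, ← hs, ← Multiset.map_univ s (· ^ k)]
    rfl
  constructor
  · intro hH z₀ hz₀
    by_contra him
    have hconj : conj z₀ ∈ s := by
      rw [hmem, aeval_conj, hz₀, map_zero]
    obtain ⟨f, hfdeg, hf⟩ : ∃ f : ℂ[X], f.degree < d ∧
        ∀ z ∈ s, f.eval z = if z = z₀ then 1 else if z = conj z₀ then -1 else 0 := by
      refine ⟨Lagrange.interpolate s.toFinset id
        fun z => if z = z₀ then 1 else if z = conj z₀ then -1 else 0, ?_, fun z hz => ?_⟩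
      · refine (Lagrange.degree_interpolate_lt _ Function.injective_id.injOn).trans_le ?_
        have h1 : s.toFinset.card ≤ d := by
          refine (Multiset.toFinset_card_le s).trans ((card_roots' _).trans ?_)
          simp [charpoly_natDegree_eq_dim]
        exact_mod_cast h1
      · exact Lagrange.eval_interpolate_at_node _ Function.injective_id.injOn
          (Multiset.mem_toFinset.2 hz)
    have hfeval (z : ℂ) : f.eval z = ∑ i : Fin d, f.coeff i * z ^ (i : ℕ) := by
      rw [eval_eq_sum, sum_fin (fun i c => c * z ^ i) (by simp) hfdeg]
    have hne : conj z₀ ≠ z₀ := fun h => him (Complex.conj_eq_iff_im.1 h)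
    have hquad := hH.map_ofReal.dotProduct_mulVec_nonneg fun i => f.coeff i
    have hval : (star fun i : Fin d => f.coeff i) ⬝ᵥ
        (((Matrix.of fun i j : Fin d => (A ^ ((i : ℕ) + (j : ℕ))).trace).map Complex.ofReal) *ᵥ
          fun i => f.coeff i) = ∑ z : s, conj (f.eval (conj (z : ℂ))) * f.eval (z : ℂ) := by
      simp only [dotProduct, mulVec, map_apply, of_apply, htr, hfeval, map_sum, map_mul, map_pow,
        Complex.conj_conj, Finset.sum_mul, Finset.mul_sum]
      rw [Finset.sum_comm_cycle]
      refine Finset.sum_congr rfl fun z _ => Finset.sum_comm.trans <|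
        Finset.sum_congr rfl fun i _ => Finset.sum_congr rfl fun j _ => ?_
      simp only [Pi.star_apply, starRingEnd_apply]
      ring
    rw [hval] at hquad
    have hneg : (∑ z : s, conj (f.eval (conj (z : ℂ))) * f.eval (z : ℂ)).re < 0 := by
      rw [Complex.re_sum]
      have hmem₀ := (hmem z₀).2 hz₀
      have hle (z : s) : (conj (f.eval (conj (z : ℂ))) * f.eval (z : ℂ)).re ≤ 0 := by
        have hz : (z : ℂ) ∈ s := Multiset.coe_mem
        rcases eq_or_ne (z : ℂ) z₀ with h | h
        · simp [h, hf _ hconj, hf _ hmem₀, hne]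
        rcases eq_or_ne (z : ℂ) (conj z₀) with h' | h'
        · simp [h', hf _ hconj, hf _ hmem₀, hne]
        · simp [hf _ hz, h, h']
      refine Finset.sum_neg' (fun z _ => hle z)
        ⟨s.mkToType z₀ ⟨0, Multiset.count_pos.2 hmem₀⟩, Finset.mem_univ _, ?_⟩
      simp [hf _ hconj, hf _ hmem₀, hne]
    exact absurd (Complex.nonneg_iff.1 hquad).1 hneg.not_ge
  · intro hreal
    let V : Matrix s (Fin d) ℝ := Matrix.of fun z j => (z : ℂ).re ^ (j : ℕ)
    convert posSemidef_conjTranspose_mul_self V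
    ext i j
    apply Complex.ofReal_injective
    have hre (z : s) : (((z : ℂ).re : ℝ) : ℂ) = z :=
      Complex.ext rfl (hreal z ((hmem z).1 (Multiset.coe_mem))).symm
    rw [of_apply, htr]
    simp [V, mul_apply, hre, pow_add]

open Polynomial in
/-- The characteristic polynomial of the companion matrix of a monic polynomial `P`. -/
theorem Matrix.charpoly_companion {K : Type*} [Field K] {d : ℕ} {P : K[X]} (hP : P.Monic)
    (hd : P.natDegree = d) :
    (Matrix.of fun i j : Fin d =>
      if (j : ℕ) + 1 = d then -P.coeff i else if (i : ℕ) = j + 1 then 1 else 0).charpoly = P := by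
  subst hd
  have h := charpoly_leftMulMatrix (AdjoinRoot.powerBasis' hP)
  have hmin : minpoly K (AdjoinRoot.powerBasis' hP).gen = P := by
    rw [AdjoinRoot.powerBasis'_gen, AdjoinRoot.minpoly_root hP.ne_zero, hP.leadingCoeff]
    simp
  rw [PowerBasis.leftMulMatrix, PowerBasis.minpolyGen_eq, hmin] at h
  exact h

open Polynomial in
/-- The polynomial `t ↦ Σ_{i=0}^d p_i(a) t^{d-i}`, where `p_i` is the homogeneous component of
degree `i` of `p`. -/
noncomputable def MvPolynomial.reversedAlong {n : ℕ} (d : ℕ) (p : MvPolynomial (Fin n) ℝ)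
    (a : Fin n → ℝ) : ℝ[X] :=
  ∑ i ∈ Finset.range (d + 1),
    Polynomial.monomial (d - i) (MvPolynomial.eval a (homogeneousComponent i p))

theorem MvPolynomial.coeff_reversedAlong {n d : ℕ} (p : MvPolynomial (Fin n) ℝ)
    (a : Fin n → ℝ) {k : ℕ} (hk : k ≤ d) :
    (reversedAlong d p a).coeff k = MvPolynomial.eval a (homogeneousComponent (d - k) p) := by
  rw [reversedAlong, Polynomial.finsetSum_coeff, Finset.sum_eq_single (d - k)]
  · rw [Nat.sub_sub_self hk, Polynomial.coeff_monomial_same]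
  · intro i hi hne
    rw [Polynomial.coeff_monomial_of_ne]
    grind
  · grind

theorem MvPolynomial.natDegree_reversedAlong_le {n : ℕ} (d : ℕ) (p : MvPolynomial (Fin n) ℝ)
    (a : Fin n → ℝ) : (reversedAlong d p a).natDegree ≤ d :=
  Polynomial.natDegree_sum_le_of_forall_le _ _ fun i _ =>
    (Polynomial.natDegree_monomial_le _).trans (Nat.sub_le d i)

theorem MvPolynomial.aeval_smul_homogeneousComponent {n : ℕ} (p : MvPolynomial (Fin n) ℝ) (i : ℕ)
    (a : Fin n → ℝ) (z : ℂ) :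
    aeval (fun j => z * algebraMap ℝ ℂ (a j)) (homogeneousComponent i p) =
      z ^ i * algebraMap ℝ ℂ (eval a (homogeneousComponent i p)) := by
  rw [aeval_def, eval₂_eq', eval_eq', map_sum, Finset.mul_sum]
  refine Finset.sum_congr rfl fun m hm => ?_
  have hdeg : ∑ j, m j = i := by
    rw [← Finsupp.degree_eq_sum, Finsupp.degree_eq_weight_one]
    exact homogeneousComponent_isHomogeneous i p (mem_support_iff.1 hm)
  simp_rw [mul_pow, Finset.prod_mul_distrib, Finset.prod_pow_eq_pow_sum, hdeg, map_mul, map_prod,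
    map_pow]
  ring

theorem MvPolynomial.aeval_reversedAlong {n d : ℕ} {p : MvPolynomial (Fin n) ℝ}
    (hp : p.totalDegree = d) (a : Fin n → ℝ) {z : ℂ} (hz : z ≠ 0) :
    Polynomial.aeval z (reversedAlong d p a) =
      z ^ d * aeval (fun j => z⁻¹ * algebraMap ℝ ℂ (a j)) p := by
  conv_rhs => rw [← sum_homogeneousComponent p, hp]
  rw [reversedAlong, map_sum, map_sum, Finset.mul_sum]
  refine Finset.sum_congr rfl fun i hi => ?_
  rw [aeval_smul_homogeneousComponent, Polynomial.aeval_monomial,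
    pow_sub₀ z hz (Nat.lt_succ_iff.1 (Finset.mem_range.1 hi)), inv_pow]
  ring

theorem MvPolynomial.isRealZero_iff_reversedAlong {n d : ℕ} {p : MvPolynomial (Fin n) ℝ}
    (h0 : constantCoeff p = 1) (hp : p.totalDegree = d) :
    IsRealZero p ↔
      ∀ (a : Fin n → ℝ) (z : ℂ), Polynomial.aeval z (reversedAlong d p a) = 0 → z.im = 0 := by
  refine ⟨fun h a z hz => ?_, fun h => ⟨h0, fun a z hz => ?_⟩⟩
  · rcases eq_or_ne z 0 with rfl | hz0
    · rfl
    rw [aeval_reversedAlong hp a hz0] at hz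
    have := h.2 a _ ((mul_eq_zero.1 hz).resolve_left (pow_ne_zero _ hz0))
    simpa [Complex.inv_im, hz0] using this
  · rcases eq_or_ne z 0 with rfl | hz0
    · rfl
    have := h a z⁻¹ (by rw [aeval_reversedAlong hp a (inv_ne_zero hz0), inv_inv, hz, mul_zero])
    simpa [Complex.inv_im, hz0] using this

/-- A polynomial `p` with `p(0) = 1` and `deg p = d ≥ 1` is a real-zero polynomial if and
only if the evaluation `𝓗(p)(a)` of the parametrized Hermite matrix is positive
semidefinite for every `a ∈ ℝⁿ`. -/
theorem isRealZero_iff_hermite_posSemidef {n : ℕ} (p : MvPolynomial (Fin n) ℝ) (d : ℕ)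
    (hd : 1 ≤ d) (h0 : MvPolynomial.constantCoeff p = 1) (hdeg : p.totalDegree = d) :
    IsRealZero p ↔
      ∀ a : Fin n → ℝ, ((hermiteM d p).map (MvPolynomial.eval a)).PosSemidef := by
  rw [MvPolynomial.isRealZero_iff_reversedAlong h0 hdeg]
  refine forall_congr' fun a => ?_
  set P := MvPolynomial.reversedAlong d p a with hP
  have hcoeff : P.coeff d = 1 := by
    rw [hP, MvPolynomial.coeff_reversedAlong p a le_rfl]
    simpa [MvPolynomial.homogeneousComponent_zero, MvPolynomial.constantCoeff_eq] using h0
  have hle : P.natDegree ≤ d := MvPolynomial.natDegree_reversedAlong_le d p a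
  have hmonic : P.Monic := Polynomial.monic_of_natDegree_le_of_coeff_eq_one d hle hcoeff
  have hnat : P.natDegree = d :=
    hle.antisymm (Polynomial.le_natDegree_of_ne_zero (by simp [hcoeff]))
  have hcomp : (companionM d p).map (MvPolynomial.eval a) = Matrix.of fun i j : Fin d =>
      if (j : ℕ) + 1 = d then -P.coeff i else if (i : ℕ) = j + 1 then 1 else 0 := by
    ext i j
    have hj : (j : ℕ) = d - 1 ↔ (j : ℕ) + 1 = d := by omega
    simp only [Matrix.map_apply, companionM, Matrix.of_apply, hj, hP,
      MvPolynomial.coeff_reversedAlong p a i.isLt.le]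
    split_ifs <;> simp
  have hherm : (hermiteM d p).map (MvPolynomial.eval a) = Matrix.of fun i j : Fin d =>
      (((companionM d p).map (MvPolynomial.eval a)) ^ ((i : ℕ) + (j : ℕ))).trace := by
    ext i j
    have h1 : ((companionM d p).map (MvPolynomial.eval a)) ^ ((i : ℕ) + (j : ℕ)) =
        ((companionM d p) ^ ((i : ℕ) + (j : ℕ))).map (MvPolynomial.eval a) :=
      (map_pow ((MvPolynomial.eval a).mapMatrix (m := Fin d)) _ _).symm
    simp [hermiteM, h1, Matrix.trace]
  rw [hherm, Matrix.posSemidef_trace_pow_iff, hcomp, Matrix.charpoly_companion hmonic hnat]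
end

section
/- Let p ∈ ℝ[x₁,…,xₙ] be a real-zero polynomial of degree d, and suppose p^r = det(I − 𝓜) for some r > 0 and some symmetric linear matrix polynomial 𝓜 of size k. Then for all 1 ≤ i,j ≤ d with (i,j) ≠ (1,1) one has r · 𝓗(p)_{i,j} = trace(𝓜^{i+j−2}) in ℝ[x₁,…,xₙ], while 𝓗(p)_{1,1} = d and trace(𝓜⁰) = k. -/
open Matrix

open Polynomial in
/-- Factorization of `det (1 - (t A)^m)` over the `m`-th roots of unity. -/
theorem expand_charpolyRev_pow {R ι : Type*} [CommRing R] [IsDomain R] [Infinite R] [Fintype ι]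
    [DecidableEq ι] {m : ℕ} (hm : 0 < m) {ζ : R} (hζ : IsPrimitiveRoot ζ m) (A : Matrix ι ι R) :
    expand R m (A ^ m).charpolyRev =
      ∏ μ ∈ nthRootsFinset m (1 : R), A.charpolyRev.comp (C μ * X) := by
  have key : (1 - X ^ m : R[X]) = ∏ μ ∈ nthRootsFinset m (1 : R), (1 - C μ * X) := by
    refine Polynomial.funext fun a => ?_
    simpa [eval_prod] using hζ.pow_sub_pow_eq_prod_sub_mul (x := 1) (y := a) hm
  have hdet := congrArg
    (detMonoidHom.comp (aeval (R := R) ((X : R[X]) • A.map C) : R[X] →* Matrix ι ι R[X])) key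
  rw [map_prod] at hdet
  convert hdet using 1
  · rw [charpolyRev, AlgHom.map_det]
    simp only [MonoidHom.comp_apply, MonoidHom.coe_coe, map_sub, map_one, map_pow, aeval_X,
      coe_detMonoidHom, _root_.smul_pow]
    congr 1
    rw [← Matrix.map_pow A (C : R →+* R[X]) m]
    ext1 i j
    by_cases h : i = j <;> simp [h]
  · refine Finset.prod_congr rfl fun μ _ => ?_
    rw [charpolyRev, ← coe_compRingHom_apply, RingHom.map_det]
    simp only [MonoidHom.comp_apply, MonoidHom.coe_coe, map_sub, map_one, map_mul, aeval_X,
      aeval_C, coe_detMonoidHom]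
    congr 1
    ext1 i j
    by_cases h : i = j <;> simp [h, Matrix.algebraMap_eq_diagonal] <;> ring

open Polynomial in
theorem coeff_one_pow_of_coeff_zero_eq_one {R : Type*} [CommRing R] {f : R[X]}
    (hf : f.coeff 0 = 1) (r : ℕ) : (f ^ r).coeff 1 = r * f.coeff 1 := by
  induction r with
  | zero => simp [coeff_one]
  | succ r ih =>
    rw [pow_succ, coeff_mul, Finset.Nat.antidiagonal_succ]
    have h0 : (f ^ r).coeff 0 = 1 := by rw [coeff_zero_eq_eval_zero, eval_pow,
      ← coeff_zero_eq_eval_zero, hf, one_pow]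
    simp [ih, hf, h0]
    ring

theorem charpolyRev_map {R S ι : Type*} [CommRing R] [CommRing S] [Fintype ι] [DecidableEq ι]
    (f : R →+* S) (A : Matrix ι ι R) : (A.map f).charpolyRev = A.charpolyRev.map f := by
  rw [charpolyRev, charpolyRev, ← Polynomial.coe_mapRingHom, RingHom.map_det]
  congr 1
  ext i j : 2
  by_cases h : i = j <;> simp [h]

/-- If `det (1 - t A) = det (1 - t B) ^ r`, then the traces of the positive powers of `A` are
`r` times those of `B`. -/
theorem trace_pow_eq_of_charpolyRev_eq_pow {R ι κ : Type*} [CommRing R] [IsDomain R]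
    [CharZero R] [Fintype ι] [DecidableEq ι] [Fintype κ] [DecidableEq κ]
    {A : Matrix ι ι R} {B : Matrix κ κ R} {r : ℕ}
    (h : A.charpolyRev = B.charpolyRev ^ r) {m : ℕ} (hm : 0 < m) :
    (A ^ m).trace = r * (B ^ m).trace := by
  let K := AlgebraicClosure (FractionRing R)
  let φ : R →+* K := algebraMap R K
  have hφ : Function.Injective φ := by
    rw [show φ = (algebraMap (FractionRing R) K).comp (algebraMap R (FractionRing R)) from
      IsScalarTower.algebraMap_eq R (FractionRing R) K]
    exact (algebraMap (FractionRing R) K).injective.comp (IsFractionRing.injective R _)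
  have : CharZero K := charZero_of_injective_ringHom hφ
  have : Infinite K := Infinite.of_injective (Nat.cast : ℕ → K) Nat.cast_injective
  have : NeZero (m : K) := ⟨by exact_mod_cast hm.ne'⟩
  obtain ⟨ζ, hζ⟩ := HasEnoughRootsOfUnity.exists_primitiveRoot K m
  have hAB : (A.map φ ^ m).charpolyRev = (B.map φ ^ m).charpolyRev ^ r := by
    apply Polynomial.expand_injective hm
    rw [map_pow, expand_charpolyRev_pow hm hζ, expand_charpolyRev_pow hm hζ,
      charpolyRev_map, charpolyRev_map, h, ← Finset.prod_pow]
    simp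
  have h1 := congrArg (fun f => f.coeff 1) hAB
  rw [coeff_one_pow_of_coeff_zero_eq_one
    (by rw [Polynomial.coeff_zero_eq_eval_zero, eval_charpolyRev])] at h1
  rw [coeff_charpolyRev_eq_neg_trace, coeff_charpolyRev_eq_neg_trace, mul_neg, neg_inj] at h1
  apply hφ
  simpa [← Matrix.map_pow, AddMonoidHom.map_trace] using h1

open Polynomial in
/-- The characteristic polynomial of a companion matrix. -/
theorem charpoly_of_companion {R : Type*} [CommRing R] [Nontrivial R] {f : R[X]} (hf : f.Monic)
    {d : ℕ} (hd : f.natDegree = d) :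
    (Matrix.of fun i j : Fin d => if (j : ℕ) = d - 1 then -f.coeff i
      else if (i : ℕ) = (j : ℕ) + 1 then 1 else 0).charpoly = f := by
  subst hd
  let pb := AdjoinRoot.powerBasis' hf
  have hmin : f = minpoly R pb.gen := by
    refine minpoly.unique' R pb.gen hf (by simp [pb]) fun q hq => or_iff_not_imp_left.2 ?_
    intro h0 h1
    have := pb.dim_le_degree_of_root h0 h1
    rw [degree_eq_natDegree hf.ne_zero] at hq
    exact absurd hq (not_lt.2 this)
  have hL := pb.leftMulMatrix
  rw [pb.minpolyGen_eq, ← hmin] at hL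
  refine Eq.trans ?_ ((charpoly_leftMulMatrix pb).trans hmin.symm)
  rw [hL]
  congr 1
  ext i j
  have hj : (j : ℕ) < f.natDegree := j.2
  have e : ((j : ℕ) = f.natDegree - 1) ↔ ((j : ℕ) + 1 = f.natDegree) := by omega
  simp only [Matrix.of_apply, e]
  rfl

/-- The substitution `p(x) ↦ p(t x)`. -/
noncomputable def scaleVars (n : ℕ) :
    MvPolynomial (Fin n) ℝ →ₐ[ℝ] Polynomial (MvPolynomial (Fin n) ℝ) :=
  MvPolynomial.aeval fun i => Polynomial.X * Polynomial.C (MvPolynomial.X i)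

theorem scaleVars_monomial {n : ℕ} (s : Fin n →₀ ℕ) (c : ℝ) :
    scaleVars n (MvPolynomial.monomial s c) =
      Polynomial.monomial s.degree (MvPolynomial.monomial s c) := by
  rw [scaleVars, MvPolynomial.aeval_monomial, Finsupp.prod]
  simp only [mul_pow, Finset.prod_mul_distrib, Finset.prod_pow_eq_pow_sum]
  rw [← Polynomial.C_mul_X_pow_eq_monomial, MvPolynomial.monomial_eq, Finsupp.prod]
  simp only [map_mul, map_prod, map_pow, Finsupp.degree_apply]
  rw [Polynomial.algebraMap_apply, MvPolynomial.algebraMap_eq]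
  ring

theorem coeff_scaleVars {n : ℕ} (p : MvPolynomial (Fin n) ℝ) (i : ℕ) :
    (scaleVars n p).coeff i = MvPolynomial.homogeneousComponent i p := by
  induction p using MvPolynomial.induction_on' with
  | monomial s c =>
    rw [scaleVars_monomial, Polynomial.coeff_monomial,
      MvPolynomial.homogeneousComponent_of_mem
        (MvPolynomial.isHomogeneous_monomial c rfl : (MvPolynomial.monomial s c).IsHomogeneous _)]
    simp [eq_comm]
  | add p q hp hq => simp [hp, hq]

theorem charpolyRev_companionM {n d : ℕ} {p : MvPolynomial (Fin n) ℝ}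
    (h0 : MvPolynomial.constantCoeff p = 1) (hdeg : p.totalDegree = d) :
    (companionM d p).charpolyRev = scaleVars n p := by
  have hle : (scaleVars n p).natDegree ≤ d := by
    refine Polynomial.natDegree_le_iff_coeff_eq_zero.2 fun i hi => ?_
    rw [coeff_scaleVars, MvPolynomial.homogeneousComponent_eq_zero _ _ (by omega)]
  set f := (scaleVars n p).reflect d with hf
  have hcoeff : f.coeff d = 1 := by
    rw [hf, Polynomial.coeff_reflect, Polynomial.revAt_le le_rfl, Nat.sub_self, coeff_scaleVars,
      MvPolynomial.homogeneousComponent_zero, ← MvPolynomial.constantCoeff_eq, h0, map_one]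
  have hfle : f.natDegree ≤ d := Polynomial.natDegree_reflect_le.trans (by simp [hle])
  have hmonic : f.Monic := Polynomial.monic_of_natDegree_le_of_coeff_eq_one d hfle hcoeff
  have hfd : f.natDegree = d :=
    le_antisymm hfle (Polynomial.le_natDegree_of_ne_zero (by simp [hcoeff]))
  have hchar : (companionM d p).charpoly = f := by
    rw [← charpoly_of_companion hmonic hfd]
    congr 1
    ext1 i j
    simp only [companionM, Matrix.of_apply, hf, Polynomial.coeff_reflect,
      Polynomial.revAt_le i.2.le, coeff_scaleVars]
  rw [← reverse_charpoly, hchar, Polynomial.reverse, hfd, hf, Polynomial.reflect_reflect]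

theorem charpolyRev_pencil {n k : ℕ} (M : Fin n → Matrix (Fin k) (Fin k) ℝ) :
    (pencil M).charpolyRev = scaleVars n (Matrix.det (1 - pencil M)) := by
  rw [charpolyRev, AlgHom.map_det]
  congr 1
  ext1 i j
  have : scaleVars n (pencil M i j) = Polynomial.X * Polynomial.C (pencil M i j) := by
    simp only [pencil, map_sum, map_mul, Finset.mul_sum]
    refine Finset.sum_congr rfl fun l _ => ?_
    simp only [scaleVars, MvPolynomial.aeval_X, MvPolynomial.algHom_C, Polynomial.algebraMap_apply,
      MvPolynomial.algebraMap_eq, mul_assoc]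
  by_cases h : i = j
  · subst h
    simp [this]
  · simp [h, this]

/-- Let `p` be a real-zero polynomial of degree `d` with `p^r = det(I - 𝓜)` for a symmetric
linear matrix polynomial `𝓜` of size `k` and some `r > 0`. Then
`r · 𝓗(p)_{i,j} = trace(𝓜^{i+j-2})` for all `(i,j) ≠ (1,1)` (1-based), while
`𝓗(p)_{1,1} = d` and `trace(𝓜⁰) = k`. -/
theorem hermite_entries_of_detRep {n k : ℕ} (p : MvPolynomial (Fin n) ℝ) (d : ℕ)
    (hRZ : IsRealZero p) (hdeg : p.totalDegree = d) (r : ℕ) (hr : 0 < r)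
    (M : Fin n → Matrix (Fin k) (Fin k) ℝ) (hsymm : ∀ l, (M l).IsSymm)
    (hdet : p ^ r = Matrix.det (1 - pencil M)) :
    (∀ i j : Fin d, ¬((i : ℕ) = 0 ∧ (j : ℕ) = 0) →
        (r : MvPolynomial (Fin n) ℝ) * hermiteM d p i j =
          Matrix.trace (pencil M ^ ((i : ℕ) + (j : ℕ)))) ∧
    (∀ i j : Fin d, (i : ℕ) = 0 → (j : ℕ) = 0 →
        hermiteM d p i j = (d : MvPolynomial (Fin n) ℝ)) ∧
    Matrix.trace (pencil M ^ 0) = (k : MvPolynomial (Fin n) ℝ) := by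
  have hrev : (pencil M).charpolyRev = (companionM d p).charpolyRev ^ r := by
    rw [charpolyRev_pencil, ← hdet, map_pow, charpolyRev_companionM hRZ.1 hdeg]
  refine ⟨fun i j hij => ?_, fun i j hi hj => ?_, ?_⟩
  · exact (trace_pow_eq_of_charpolyRev_eq_pow hrev (by omega)).symm
  · simp [hermiteM, hi, hj, Matrix.trace_one]
  · simp [Matrix.trace_one]
end

section
/- Let p ∈ ℝ[x₁,…,xₙ] be a real-zero polynomial of degree d. If for some r > 0 the power p^r admits a definite determinantal representation of size r·d, i.e. p^r = det(I − 𝓜) for a symmetric linear matrix polynomial 𝓜 of size r·d, then the parametrized Hermite matrix 𝓗(p) is a sum of squares: there exist k > 0 and a k×d matrix 𝓠 with entries in ℝ[x₁,…,xₙ] such that 𝓗(p) = 𝓠ᵀ𝓠. -/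
open Matrix

open Polynomial in
theorem det_aeval_X_add_C {K n : Type*} [CommRing K] [Fintype n] [DecidableEq n]
    (A : Matrix n n K) (a : K) :
    (aeval A (X + C a)).det = (-1) ^ Fintype.card n * A.charpoly.eval (-a) := by
  rw [Matrix.eval_charpoly, ← Matrix.det_neg]
  congr 1
  simp [Matrix.algebraMap_eq_diagonal, ← Matrix.diagonal_neg, Pi.algebraMap_def]

open Polynomial in
theorem det_aeval_eq_pow_of_charpoly_eq_pow {K m n : Type*} [Field K] [Fintype m] [DecidableEq m]
    [Fintype n] [DecidableEq n] {A : Matrix m m K} {B : Matrix n n K} {r : ℕ}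
    (h : B.charpoly = A.charpoly ^ r) {f : K[X]} (hf : f.Splits) :
    (aeval B f).det = (aeval A f).det ^ r := by
  have hcard : Fintype.card n = Fintype.card m * r := by
    simpa [A.charpoly_monic.natDegree_pow, mul_comm] using congrArg natDegree h
  induction hf using Submonoid.closure_induction with
  | mem f hf =>
    obtain ⟨a, rfl⟩ | ⟨a, rfl⟩ := hf
    · simp [Matrix.algebraMap_eq_diagonal, hcard, pow_mul]
    · rw [det_aeval_X_add_C, det_aeval_X_add_C, h, hcard, eval_pow, mul_pow, pow_mul]
  | one => simp
  | mul f g _ _ hf hg => simp [hf, hg, mul_pow]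

open Polynomial in
theorem trace_pow_eq_of_charpoly_eq_pow {K m n : Type*} [Field K] [IsAlgClosed K] [Fintype m]
    [DecidableEq m] [Fintype n] [DecidableEq n] {A : Matrix m m K} {B : Matrix n n K} {r : ℕ}
    (h : B.charpoly = A.charpoly ^ r) (s : ℕ) :
    (B ^ s).trace = r * (A ^ s).trace := by
  have hs : (B ^ s).charpoly = (A ^ s).charpoly ^ r := by
    refine Polynomial.funext fun t => ?_
    have := det_aeval_eq_pow_of_charpoly_eq_pow h (IsAlgClosed.splits (C t - X ^ s))
    simpa [Matrix.eval_charpoly, Matrix.algebraMap_eq_diagonal, Pi.algebraMap_def] using this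
  rw [Matrix.trace_eq_sum_roots_charpoly, Matrix.trace_eq_sum_roots_charpoly, hs]
  simp [Multiset.sum_nsmul]

open Polynomial in
theorem charpoly_companion {R : Type*} [CommRing R] {g : R[X]} (hg : g.Monic) :
    (Matrix.of fun i j : Fin g.natDegree => if (j : ℕ) + 1 = g.natDegree then -g.coeff i else
      if (i : ℕ) = j + 1 then 1 else 0).charpoly = g := by
  nontriviality R
  have hmin : minpoly R (AdjoinRoot.root g) = g := by
    refine (minpoly.unique' R _ hg (by simp) fun q hq => ?_).symm
    by_contra! hcon
    rw [AdjoinRoot.aeval_eq, AdjoinRoot.mk_eq_zero] at hcon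
    exact hg.not_dvd_of_degree_lt hcon.1 hq hcon.2
  have := charpoly_leftMulMatrix (AdjoinRoot.powerBasis' hg)
  rwa [PowerBasis.leftMulMatrix, PowerBasis.minpolyGen_eq, AdjoinRoot.powerBasis'_gen, hmin] at this

open Polynomial in
theorem aeval_X_mul_C_X_of_isHomogeneous {σ R : Type*} [CommRing R]
    {p : MvPolynomial σ R} {k : ℕ} (hp : p.IsHomogeneous k) :
    MvPolynomial.aeval (fun i => (X : (MvPolynomial σ R)[X]) * C (MvPolynomial.X i)) p =
      C p * X ^ k := by
  conv_rhs => rw [p.as_sum, map_sum, Finset.sum_mul]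
  rw [MvPolynomial.aeval_def, MvPolynomial.eval₂_eq]
  refine Finset.sum_congr rfl fun m hm => ?_
  have hdeg : ∑ i ∈ m.support, m i = k := by
    rw [← hp (MvPolynomial.mem_support_iff.mp hm), Finsupp.weight_apply]
    simp [Finsupp.sum]
  rw [MvPolynomial.monomial_eq]
  simp only [mul_pow, Finset.prod_mul_distrib, Finset.prod_pow_eq_pow_sum, hdeg, map_mul, map_prod,
    map_pow, Finsupp.prod]
  change C (MvPolynomial.C _) * _ = _
  ring

open Polynomial in
theorem aeval_X_mul_C_X {σ R : Type*} [CommRing R] (p : MvPolynomial σ R) :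
    MvPolynomial.aeval (fun i => (X : (MvPolynomial σ R)[X]) * C (MvPolynomial.X i)) p =
      ∑ i ∈ Finset.range (p.totalDegree + 1),
        C (MvPolynomial.homogeneousComponent i p) * X ^ i := by
  conv_lhs => rw [← p.sum_homogeneousComponent, map_sum]
  exact Finset.sum_congr rfl fun i _ =>
    aeval_X_mul_C_X_of_isHomogeneous (MvPolynomial.homogeneousComponent_isHomogeneous i p)

open Polynomial in
/-- The homogenization of `p` with respect to a new variable. -/
noncomputable def homogenization {σ : Type*} (p : MvPolynomial σ ℝ) : (MvPolynomial σ ℝ)[X] :=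
  ∑ i ∈ Finset.range (p.totalDegree + 1),
    C (MvPolynomial.homogeneousComponent (p.totalDegree - i) p) * X ^ i

section
open Polynomial

variable {σ : Type*} {p : MvPolynomial σ ℝ}

theorem coeff_homogenization {i : ℕ} (hi : i ≤ p.totalDegree) :
    (homogenization p).coeff i = MvPolynomial.homogeneousComponent (p.totalDegree - i) p := by
  simp [homogenization, finsetSum_coeff, coeff_C_mul, coeff_X_pow, hi]

theorem natDegree_homogenization_le : (homogenization p).natDegree ≤ p.totalDegree :=
  natDegree_sum_le_of_forall_le _ _ fun _ hi =>
    (natDegree_C_mul_X_pow_le _ _).trans (Nat.lt_succ_iff.mp (Finset.mem_range.mp hi))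

theorem coeff_homogenization_totalDegree (hp : MvPolynomial.constantCoeff p = 1) :
    (homogenization p).coeff p.totalDegree = 1 := by
  rw [coeff_homogenization le_rfl, Nat.sub_self, MvPolynomial.homogeneousComponent_zero,
    ← MvPolynomial.constantCoeff_eq, hp, map_one]

theorem natDegree_homogenization (hp : MvPolynomial.constantCoeff p = 1) :
    (homogenization p).natDegree = p.totalDegree :=
  natDegree_eq_of_le_of_coeff_ne_zero natDegree_homogenization_le
    (by simp [coeff_homogenization_totalDegree hp])

theorem monic_homogenization (hp : MvPolynomial.constantCoeff p = 1) :
    (homogenization p).Monic :=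
  monic_of_natDegree_le_of_coeff_eq_one _ natDegree_homogenization_le
    (coeff_homogenization_totalDegree hp)

theorem reverse_homogenization (hp : MvPolynomial.constantCoeff p = 1) :
    (homogenization p).reverse =
      MvPolynomial.aeval (fun i => (X : (MvPolynomial σ ℝ)[X]) * C (MvPolynomial.X i)) p := by
  rw [aeval_X_mul_C_X]
  ext1 i
  rw [reverse, coeff_reflect, natDegree_homogenization hp]
  by_cases hi : i ≤ p.totalDegree
  · rw [revAt_le hi, coeff_homogenization (Nat.sub_le _ _), Nat.sub_sub_self hi]
    simp [finsetSum_coeff, coeff_C_mul, coeff_X_pow, hi]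
  · rw [revAt_eq_self_of_lt (not_le.mp hi), coeff_eq_zero_of_natDegree_lt
      (natDegree_homogenization_le.trans_lt (not_le.mp hi))]
    simp [finsetSum_coeff, coeff_C_mul, coeff_X_pow, hi]

theorem charpoly_companionM {n : ℕ} {p : MvPolynomial (Fin n) ℝ}
    (hp : MvPolynomial.constantCoeff p = 1) :
    (companionM p.totalDegree p).charpoly = homogenization p := by
  rw [← charpoly_companion (monic_homogenization hp)]
  have hd := natDegree_homogenization hp
  rw [show companionM p.totalDegree p = (Matrix.of fun i j : Fin p.totalDegree =>
      if (j : ℕ) + 1 = p.totalDegree then -(homogenization p).coeff i else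
      if (i : ℕ) = j + 1 then 1 else 0) from ?_]
  · rw [← hd]
  · ext1 i j
    rw [Matrix.of_apply, companionM, coeff_homogenization i.is_lt.le]
    have := j.is_lt
    simp only [show (j : ℕ) = p.totalDegree - 1 ↔ (j : ℕ) + 1 = p.totalDegree by lia]

theorem charpoly_pencil_eq_pow {n r : ℕ} {p : MvPolynomial (Fin n) ℝ}
    (hp : MvPolynomial.constantCoeff p = 1)
    {M : Fin n → Matrix (Fin (r * p.totalDegree)) (Fin (r * p.totalDegree)) ℝ}
    (hdet : p ^ r = (1 - pencil M).det) :
    (pencil M).charpoly = homogenization p ^ r := by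
  have hrev : MvPolynomial.aeval
      (fun i => (X : (MvPolynomial (Fin n) ℝ)[X]) * C (MvPolynomial.X i)) (p ^ r) =
      (pencil M).charpolyRev := by
    rw [hdet, AlgHom.map_det, Matrix.charpolyRev]
    congr 1
    ext1 i j
    simp only [AlgHom.mapMatrix_apply, Matrix.map_apply, Matrix.sub_apply, Matrix.smul_apply,
      map_sub, Matrix.one_apply, pencil, map_sum, map_mul, MvPolynomial.aeval_X,
      MvPolynomial.aeval_C, MvPolynomial.algebraMap_eq,
      IsScalarTower.algebraMap_apply ℝ (MvPolynomial (Fin n) ℝ) (MvPolynomial (Fin n) ℝ)[X],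
      algebraMap_eq, smul_eq_mul, mul_assoc, Finset.mul_sum]
    congr 1
    split_ifs <;> simp
  have hdeg : (homogenization p ^ r).natDegree = (pencil M).charpoly.natDegree := by
    simp [(monic_homogenization hp).natDegree_pow, natDegree_homogenization hp]
  have hrevp : (homogenization p ^ r).reverse = (homogenization p).reverse ^ r := by
    clear hrev hdeg hdet M
    induction r with
    | zero => simpa using reverse_C (1 : MvPolynomial (Fin n) ℝ)
    | succ r ih => rw [pow_succ, reverse_mul_of_domain, ih, pow_succ]
  rw [map_pow, ← reverse_homogenization hp, ← hrevp,
    ← Matrix.reverse_charpoly, reverse, reverse, hdeg] at hrev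
  simpa using congrArg (reflect (pencil M).charpoly.natDegree) hrev.symm

end

theorem trace_pencil_pow {n r : ℕ} {p : MvPolynomial (Fin n) ℝ}
    (hp : MvPolynomial.constantCoeff p = 1)
    {M : Fin n → Matrix (Fin (r * p.totalDegree)) (Fin (r * p.totalDegree)) ℝ}
    (hdet : p ^ r = (1 - pencil M).det) (s : ℕ) :
    (pencil M ^ s).trace = r * (companionM p.totalDegree p ^ s).trace := by
  let K := AlgebraicClosure (FractionRing (MvPolynomial (Fin n) ℝ))
  let φ : MvPolynomial (Fin n) ℝ →+* K := algebraMap _ K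
  have hφ : Function.Injective φ := (FaithfulSMul.algebraMap_injective (FractionRing (MvPolynomial (Fin n) ℝ)) K).comp
      (IsFractionRing.injective (MvPolynomial (Fin n) ℝ) _)
  have h : (φ.mapMatrix (pencil M)).charpoly =
      (φ.mapMatrix (companionM p.totalDegree p)).charpoly ^ r := by
    rw [RingHom.mapMatrix_apply, RingHom.mapMatrix_apply, Matrix.charpoly_map, Matrix.charpoly_map,
      charpoly_pencil_eq_pow hp hdet, charpoly_companionM hp, Polynomial.map_pow]
  have := trace_pow_eq_of_charpoly_eq_pow h s
  apply hφ
  rw [← map_pow, ← map_pow] at this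
  simpa only [RingHom.mapMatrix_apply, map_mul, map_natCast, AddMonoidHom.map_trace] using this

/-- Let `p` be a real-zero polynomial of degree `d`. If `p^r = det(I - 𝓜)` for some `r > 0`
and a symmetric linear matrix polynomial `𝓜` of size `r·d`, then the parametrized Hermite
matrix `𝓗(p)` is a sum of squares: `𝓗(p) = 𝓠ᵀ𝓠` for some `k × d` polynomial matrix `𝓠`. -/
theorem hermite_sos_of_detRep {n : ℕ} (p : MvPolynomial (Fin n) ℝ) (d : ℕ)
    (hRZ : IsRealZero p) (hdeg : p.totalDegree = d) (r : ℕ) (hr : 0 < r)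
    (M : Fin n → Matrix (Fin (r * d)) (Fin (r * d)) ℝ) (hsymm : ∀ l, (M l).IsSymm)
    (hdet : p ^ r = Matrix.det (1 - pencil M)) :
    ∃ (k : ℕ) (_ : 0 < k) (Q : Matrix (Fin k) (Fin d) (MvPolynomial (Fin n) ℝ)),
      hermiteM d p = Qᵀ * Q := by
  subst hdeg
  obtain hd | hd := Nat.eq_zero_or_pos p.totalDegree
  · exact ⟨1, one_pos, 0, by ext1 i; exact (Fin.cast hd i).elim0⟩
  have hpos : 0 < r * p.totalDegree := Nat.mul_pos hr hd
  let c : ℝ := (√r)⁻¹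
  have hc : c * c * r = 1 := by
    have : (0 : ℝ) < r := by exact_mod_cast hr
    have := Real.mul_self_sqrt this.le
    simp only [c]
    field_simp
    nlinarith
  have hsymm' : (pencil M).IsSymm := by
    ext1 i j
    simp [pencil, fun l => (hsymm l).apply i j]
  refine ⟨r * p.totalDegree * (r * p.totalDegree), Nat.mul_pos hpos hpos,
    Matrix.of fun a i => MvPolynomial.C c *
      (pencil M ^ (i : ℕ)) (finProdFinEquiv.symm a).1 (finProdFinEquiv.symm a).2, ?_⟩
  ext1 i j
  have hsum : (pencil M ^ ((i : ℕ) + j)).trace =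
      ∑ a, (pencil M ^ (i : ℕ)) (finProdFinEquiv.symm a).1
      (finProdFinEquiv.symm a).2 * (pencil M ^ (j : ℕ)) (finProdFinEquiv.symm a).1
      (finProdFinEquiv.symm a).2 := by
    rw [finProdFinEquiv.symm.sum_comp fun a =>
      (pencil M ^ (i : ℕ)) a.1 a.2 * (pencil M ^ (j : ℕ)) a.1 a.2, Fintype.sum_prod_type, pow_add,
      Matrix.trace]
    refine Finset.sum_congr rfl fun a _ => ?_
    rw [Matrix.diag_apply, Matrix.mul_apply]
    exact Finset.sum_congr rfl fun b _ => by rw [(hsymm'.pow j).apply]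
  have htrace := trace_pencil_pow hRZ.1 hdet ((i : ℕ) + j)
  have hC : (MvPolynomial.C c * MvPolynomial.C c * (r : MvPolynomial (Fin n) ℝ)) = 1 := by
    rw [← map_natCast MvPolynomial.C, ← map_mul, ← map_mul, hc, map_one]
  calc hermiteM p.totalDegree p i j
      = MvPolynomial.C c * MvPolynomial.C c * (pencil M ^ ((i : ℕ) + j)).trace := by
        rw [htrace, ← mul_assoc, hC, one_mul, hermiteM]
    _ = _ := by
        rw [hsum, Matrix.mul_apply, Finset.mul_sum]
        refine Finset.sum_congr rfl fun a _ => ?_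
        simp only [Matrix.transpose_apply, Matrix.of_apply]
        ring
end
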